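/- Let k = 3 and let G=(V,E) be the complete graph on n vertices. Let L be a sequence of moves for max-3-cut that is valid from some initial configuration τ_0 : V → [3], and let v be a cyclic vertex of L. Then there exists a collection of m ≥ ⌈(1/2)·⌊(b_L(v)−1)/3⌋⌉ vertices u_1,…,u_m such that (i) u_1,…,u_m ∈ A(L), (ii) the ordered pair vu_i is an L-good-arc for every i ∈ [m], and (iii) the set {vu_1,…,vu_m} is an L-neighbor-wise independent set. -/

import Mathlib

open Finset MeasureTheory ProbabilityTheory Filter
open scoped Classical

/-- Edges of the complete graph on `n` vertices: ordered pairs `(a,b)` with `a < b`. -/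
abbrev mcEdge (n : ℕ) := {e : Fin n × Fin n // e.1 < e.2}

/-- A move `(v,p,q)` for max-`k`-cut: vertex `v` moves from part `p` to part `q`. -/
abbrev KMove (n k : ℕ) := Fin n × Fin k × Fin k

/-- The inner product `⟨σ(i),σ(j)⟩` of the unit simplex vectors: `1` if `i = j`
and `−1/(k−1)` otherwise. -/
noncomputable def sigmaDot (k : ℕ) (i j : Fin k) : ℝ :=
  if i = j then 1 else -(1 / ((k : ℝ) - 1))

/-- Performing the move `m = (v,p,q)`: vertex `v` is placed in part `q`. -/
def kStep {n k : ℕ} (τ : Fin n → Fin k) (m : KMove n k) : Fin n → Fin k :=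
  Function.update τ m.1 m.2.2

/-- The configuration reached from `τ` after performing all moves of `L`. -/
def kRun {n k : ℕ} (τ : Fin n → Fin k) : List (KMove n k) → (Fin n → Fin k)
  | [] => τ
  | m :: L => kRun (kStep τ m) L

/-- `L` is a valid sequence of moves from `τ`: each move `(v,p,q)` has `p ≠ q` and is
applied when `τ(v) = p`. -/
def kValid {n k : ℕ} : (Fin n → Fin k) → List (KMove n k) → Prop
  | _, [] => True
  | τ, m :: L => τ m.1 = m.2.1 ∧ m.2.1 ≠ m.2.2 ∧ kValid (kStep τ m) L

/-- The configuration `τ_t` after the first `t` moves of `L`. -/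
def kConfAt {n k : ℕ} (τ0 : Fin n → Fin k) (L : List (KMove n k)) (t : ℕ) : Fin n → Fin k :=
  kRun τ0 (L.take t)

/-- The entry `M_{L,τ0}[{a,b},t]` of the matrix `M` for max-`k`-cut. -/
noncomputable def kM {n k : ℕ} (L : List (KMove n k)) (τ0 : Fin n → Fin k) (a b : Fin n)
    (t : Fin L.length) : ℚ :=
  if (a = (L.get t).1 ∧ (L.get t).2.2 = kConfAt τ0 L (t + 1) b) ∨
     (b = (L.get t).1 ∧ (L.get t).2.2 = kConfAt τ0 L (t + 1) a) then 1
  else if (a = (L.get t).1 ∧ (L.get t).2.1 = kConfAt τ0 L (t + 1) b) ∨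
     (b = (L.get t).1 ∧ (L.get t).2.1 = kConfAt τ0 L (t + 1) a) then -1
  else 0

/-- The set of time steps `T` is a circuit over the vertex `v` in `L`: all moves at times of
`T` are moves of `v`, consecutive moves (in increasing order of time) match up
(`q_{t_i} = p_{t_{i+1}}`), and the last move returns to the starting part
(`q_{t_w} = p_{t_1}`). -/
def IsCircuit {n k : ℕ} (L : List (KMove n k)) (v : Fin n)
    (T : Finset (Fin L.length)) : Prop :=
  T.Nonempty ∧ (∀ t ∈ T, (L.get t).1 = v) ∧
  List.Chain' (fun a b => (L.get a).2.2 = (L.get b).2.1) (T.sort (· ≤ ·)) ∧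
  ∀ h : T.Nonempty, (L.get (T.max' h)).2.2 = (L.get (T.min' h)).2.1

/-- A cycle is an inclusion-wise minimal circuit. -/
def IsCycle {n k : ℕ} (L : List (KMove n k)) (v : Fin n)
    (T : Finset (Fin L.length)) : Prop :=
  IsCircuit L v T ∧ ∀ T' ⊂ T, ¬ IsCircuit L v T'

/-- The set `Γ(L)` of cycles of `L`, as a type: a vertex together with the set of time
steps of a cycle over it. -/
abbrev KCycle {n k : ℕ} (L : List (KMove n k)) :=
  {c : Fin n × Finset (Fin L.length) // IsCycle L c.1 c.2}

/-- The entry `P_{L,τ0}[{a,b},C] = ∑_{t ∈ T(C)} M_{L,τ0}[{a,b},t]`. -/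
noncomputable def kPval {n k : ℕ} (L : List (KMove n k)) (τ0 : Fin n → Fin k)
    (a b : Fin n) (T : Finset (Fin L.length)) : ℚ :=
  ∑ t ∈ T, kM L τ0 a b t

/-- The set `S(L)` of vertices appearing in `L`. -/
def kS {n k : ℕ} (L : List (KMove n k)) : Finset (Fin n) := (L.map Prod.fst).toFinset

/-- The set `C(L)` of cyclic vertices of `L`: vertices over which some cycle of `L` lies. -/
noncomputable def cyclicSet {n k : ℕ} (L : List (KMove n k)) : Finset (Fin n) :=
  Finset.univ.filter (fun v => ∃ T, IsCycle L v T)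

/-- The set `A(L)` of acyclic vertices of `L`: vertices of `L` that are not cyclic. -/
noncomputable def acyclicSet {n k : ℕ} (L : List (KMove n k)) : Finset (Fin n) :=
  kS L \ cyclicSet L

/-- Position `t` of `L` holds a move of a cyclic vertex of `L`. -/
def cycPos {n k : ℕ} (L : List (KMove n k)) (t : ℕ) : Prop :=
  ∃ m, L[t]? = some m ∧ m.1 ∈ cyclicSet L

/-- The interval of positions `[i,j]` is a cyclic block of `L`: a maximal block of `L`
consisting only of cyclic vertices of `L`. -/
def IsCycBlock {n k : ℕ} (L : List (KMove n k)) (i j : ℕ) : Prop :=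
  i ≤ j ∧ j < L.length ∧ (∀ t, i ≤ t → t ≤ j → cycPos L t) ∧
  (i = 0 ∨ ¬ cycPos L (i - 1)) ∧ ¬ cycPos L (j + 1)

/-- `b_L(v)`: the number of cyclic blocks of `L` in which `v` occurs. -/
noncomputable def bL {n k : ℕ} (L : List (KMove n k)) (v : Fin n) : ℕ :=
  ((Finset.range L.length ×ˢ Finset.range L.length).filter
    (fun p => IsCycBlock L p.1 p.2 ∧
      ∃ t, p.1 ≤ t ∧ t ≤ p.2 ∧ ∃ m, L[t]? = some m ∧ m.1 = v)).card

/-- The contribution of a move from `p` to `q` against a vertex placed in `x`. -/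
def moveGain (p q x : Fin 3) : ℤ := if q = x then 1 else if p = x then -1 else 0

lemma moveGain_two_ne_zero : ∀ a b x y : Fin 3, a ≠ b → x ≠ y →
    moveGain a b x + moveGain b a y ≠ 0 := by decide

lemma moveGain_two_const : ∀ a b x : Fin 3, a ≠ b →
    moveGain a b x + moveGain b a x = 0 := by decide

lemma moveGain_three_ne_zero : ∀ a b c x y : Fin 3, a ≠ b → b ≠ c → c ≠ a → x ≠ y →
    moveGain a b x + moveGain b c y + moveGain c a y ≠ 0 := by decide

lemma moveGain_three_const : ∀ a b c x : Fin 3, a ≠ b → b ≠ c → c ≠ a →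
    moveGain a b x + moveGain b c x + moveGain c a x = 0 := by decide

section Runs

variable {n k : ℕ}

lemma kRun_append (τ : Fin n → Fin k) (L₁ L₂ : List (KMove n k)) :
    kRun τ (L₁ ++ L₂) = kRun (kRun τ L₁) L₂ := by
  induction L₁ generalizing τ with
  | nil => rfl
  | cons m L ih => exact ih _

lemma kConfAt_succ (τ : Fin n → Fin k) (L : List (KMove n k)) {t : ℕ} (ht : t < L.length) :
    kConfAt τ L (t + 1) = kStep (kConfAt τ L t) L[t] := by
  rw [kConfAt, List.take_succ_eq_append_getElem ht, kRun_append]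
  rfl

lemma kConfAt_of_length_le (τ : Fin n → Fin k) (L : List (KMove n k)) {t : ℕ}
    (ht : L.length ≤ t) : kConfAt τ L (t + 1) = kConfAt τ L t := by
  rw [kConfAt, kConfAt, List.take_of_length_le ht, List.take_of_length_le (by omega)]

lemma kValid.getElem {τ : Fin n → Fin k} {L : List (KMove n k)} (h : kValid τ L) {t : ℕ}
    (ht : t < L.length) : kConfAt τ L t L[t].1 = L[t].2.1 ∧ L[t].2.1 ≠ L[t].2.2 := by
  induction L generalizing τ t with
  | nil => simp at ht
  | cons m L ih =>
    cases t with
    | zero => exact ⟨h.1, h.2.1⟩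
    | succ t => exact ih h.2.2 (by simpa using ht)

lemma kConfAt_succ_self (τ : Fin n → Fin k) (L : List (KMove n k)) {t : ℕ}
    (ht : t < L.length) : kConfAt τ L (t + 1) L[t].1 = L[t].2.2 := by
  simp [kConfAt_succ τ L ht, kStep]

lemma kConfAt_succ_of_ne (τ : Fin n → Fin k) (L : List (KMove n k)) {t : ℕ}
    (ht : t < L.length) {u : Fin n} (hu : u ≠ L[t].1) :
    kConfAt τ L (t + 1) u = kConfAt τ L t u := by
  simp [kConfAt_succ τ L ht, kStep, hu]

lemma kValid.moves_iff {τ : Fin n → Fin k} {L : List (KMove n k)} (h : kValid τ L)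
    (u : Fin n) (t : ℕ) :
    kConfAt τ L t u ≠ kConfAt τ L (t + 1) u ↔ ∃ ht : t < L.length, L[t].1 = u := by
  constructor
  · intro hne
    by_cases ht : t < L.length
    · refine ⟨ht, ?_⟩
      by_contra hu
      exact hne (kConfAt_succ_of_ne τ L ht (Ne.symm hu)).symm
    · exact absurd (by rw [kConfAt_of_length_le τ L (not_lt.mp ht)]) hne
  · rintro ⟨ht, rfl⟩
    rw [kConfAt_succ_self, (h.getElem ht).1]
    exact (h.getElem ht).2

end Runs

section Cycles

variable {n k : ℕ} {L : List (KMove n k)} {v : Fin n}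

lemma not_isCircuit_singleton {t : Fin L.length} (h : (L.get t).2.1 ≠ (L.get t).2.2) :
    ¬ IsCircuit L v {t} := by
  rintro ⟨-, -, -, h4⟩
  exact h (by simpa using (h4 (by simp)).symm)

lemma sort_pair {α : Type*} [LinearOrder α] {a b : α} (h : a < b) :
    ({a, b} : Finset α).sort (· ≤ ·) = [a, b] := by
  rw [Finset.sort_insert]
  · simp
  · simp [h.le]
  · simp [h.ne]

lemma sort_triple {α : Type*} [LinearOrder α] {a b c : α} (h : a < b) (h' : b < c) :
    ({a, b, c} : Finset α).sort (· ≤ ·) = [a, b, c] := by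
  rw [Finset.sort_insert, sort_pair h']
  · simp [h.le, (h.trans h').le]
  · simp [h.ne, (h.trans h').ne]

lemma isCircuit_pair_iff {s t : Fin L.length} (hst : s < t) :
    IsCircuit L v {s, t} ↔ (L.get s).1 = v ∧ (L.get t).1 = v ∧
      (L.get s).2.2 = (L.get t).2.1 ∧ (L.get t).2.2 = (L.get s).2.1 := by
  have hmin : ∀ h, ({s, t} : Finset (Fin L.length)).min' h = s := fun h =>
    le_antisymm (Finset.min'_le _ _ (by simp)) (Finset.le_min' _ _ _ (by simp [hst.le]))
  have hmax : ∀ h, ({s, t} : Finset (Fin L.length)).max' h = t := fun h =>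
    le_antisymm (Finset.max'_le _ _ _ (by simp [hst.le])) (Finset.le_max' _ _ (by simp))
  unfold IsCircuit
  rw [sort_pair hst]
  change _ ∧ _ ∧ List.IsChain _ _ ∧ _ ↔ _
  simp [hmin, hmax, and_assoc]

lemma isCircuit_triple_iff {r s t : Fin L.length} (hrs : r < s) (hst : s < t) :
    IsCircuit L v {r, s, t} ↔ (L.get r).1 = v ∧ (L.get s).1 = v ∧ (L.get t).1 = v ∧
      (L.get r).2.2 = (L.get s).2.1 ∧ (L.get s).2.2 = (L.get t).2.1 ∧
      (L.get t).2.2 = (L.get r).2.1 := by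
  have hmin : ∀ h, ({r, s, t} : Finset (Fin L.length)).min' h = r := fun h =>
    le_antisymm (Finset.min'_le _ _ (by simp))
      (Finset.le_min' _ _ _ (by simp [hrs.le, (hrs.trans hst).le]))
  have hmax : ∀ h, ({r, s, t} : Finset (Fin L.length)).max' h = t := fun h =>
    le_antisymm (Finset.max'_le _ _ _ (by simp [hst.le, (hrs.trans hst).le]))
      (Finset.le_max' _ _ (by simp))
  unfold IsCircuit
  rw [sort_triple hrs hst]
  change _ ∧ _ ∧ List.IsChain _ _ ∧ _ ↔ _
  simp [hmin, hmax, and_assoc]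

end Cycles

section Vertices

variable {n : ℕ} {L : List (KMove n 3)} {τ : Fin n → Fin 3}

lemma kM_eq_moveGain (hL : kValid τ L) {u v : Fin n} (huv : u ≠ v) (t : Fin L.length)
    (ht : (L.get t).1 = v) :
    kM L τ v u t =
      (moveGain (kConfAt τ L t v) (kConfAt τ L (t + 1) v) (kConfAt τ L t u) : ℚ) := by
  subst ht
  have h1 := (hL.getElem t.2).1
  have h2 := kConfAt_succ_self τ L t.2
  have h3 := kConfAt_succ_of_ne τ L t.2 (u := u) (by simpa using huv)
  simp only [List.get_eq_getElem] at *
  rw [kM, h1, h2, h3, moveGain]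
  simp only [List.get_eq_getElem, huv, true_and, false_and, or_false]
  split_ifs <;> simp

/-- Two inverse moves of `v` form a cycle. -/
lemma exists_cycle_two (hL : kValid τ L) (v : Fin n) {s t : ℕ} (hst : s < t)
    (h1 : kConfAt τ L s v ≠ kConfAt τ L (s + 1) v)
    (h2 : kConfAt τ L t v = kConfAt τ L (s + 1) v)
    (h3 : kConfAt τ L (t + 1) v = kConfAt τ L s v) :
    ∃ T, IsCycle L v T ∧ ∀ u, u ≠ v → kPval L τ v u T =
      ((moveGain (kConfAt τ L s v) (kConfAt τ L t v) (kConfAt τ L s u) +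
        moveGain (kConfAt τ L t v) (kConfAt τ L s v) (kConfAt τ L t u) : ℤ) : ℚ) := by
  obtain ⟨hs, hsv⟩ := (hL.moves_iff v s).1 h1
  obtain ⟨ht, htv⟩ := (hL.moves_iff v t).1 (by rw [h2, h3]; exact h1.symm)
  have es := (hL.getElem hs).1
  have es' := kConfAt_succ_self τ L hs
  have et := (hL.getElem ht).1
  have et' := kConfAt_succ_self τ L ht
  rw [hsv] at es es'
  rw [htv] at et et'
  have hlt : (⟨s, hs⟩ : Fin L.length) < ⟨t, ht⟩ := hst
  refine ⟨{⟨s, hs⟩, ⟨t, ht⟩}, ⟨(isCircuit_pair_iff hlt).2 ?_, ?_⟩, ?_⟩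
  · simp [hsv, htv, ← es, ← es', ← et, ← et', h2, h3]
  · intro T' hT' hc
    have hsub := hT'.subset
    have hcard : T'.card < 2 := by
      have := Finset.card_lt_card hT'
      rwa [Finset.card_pair hlt.ne] at this
    have : T'.card = 1 := by have := hc.1.card_pos; omega
    obtain ⟨x, rfl⟩ := Finset.card_eq_one.1 this
    exact not_isCircuit_singleton (hL.getElem x.2).2 hc
  · intro u hu
    rw [kPval, Finset.sum_pair hlt.ne, kM_eq_moveGain hL hu _ hsv, kM_eq_moveGain hL hu _ htv]
    simp [h2, h3]

/-- Three moves of `v` rotating through the three parts form a cycle. -/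
lemma exists_cycle_three (hL : kValid τ L) (v : Fin n) {r s t : ℕ} (hrs : r < s) (hst : s < t)
    (h1 : kConfAt τ L r v ≠ kConfAt τ L s v) (h2 : kConfAt τ L s v ≠ kConfAt τ L t v)
    (h3 : kConfAt τ L t v ≠ kConfAt τ L r v)
    (e1 : kConfAt τ L (r + 1) v = kConfAt τ L s v)
    (e2 : kConfAt τ L (s + 1) v = kConfAt τ L t v)
    (e3 : kConfAt τ L (t + 1) v = kConfAt τ L r v) :
    ∃ T, IsCycle L v T ∧ ∀ u, u ≠ v → kPval L τ v u T =
      ((moveGain (kConfAt τ L r v) (kConfAt τ L s v) (kConfAt τ L r u) +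
        moveGain (kConfAt τ L s v) (kConfAt τ L t v) (kConfAt τ L s u) +
        moveGain (kConfAt τ L t v) (kConfAt τ L r v) (kConfAt τ L t u) : ℤ) : ℚ) := by
  obtain ⟨hr, hrv⟩ := (hL.moves_iff v r).1 (by rwa [e1])
  obtain ⟨hs, hsv⟩ := (hL.moves_iff v s).1 (by rwa [e2])
  obtain ⟨ht, htv⟩ := (hL.moves_iff v t).1 (by rwa [e3])
  have er := (hL.getElem hr).1
  have er' := kConfAt_succ_self τ L hr
  have es := (hL.getElem hs).1
  have es' := kConfAt_succ_self τ L hs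
  have et := (hL.getElem ht).1
  have et' := kConfAt_succ_self τ L ht
  rw [hrv] at er er'
  rw [hsv] at es es'
  rw [htv] at et et'
  have hrs' : (⟨r, hr⟩ : Fin L.length) < ⟨s, hs⟩ := hrs
  have hst' : (⟨s, hs⟩ : Fin L.length) < ⟨t, ht⟩ := hst
  have hrt' := hrs'.trans hst'
  refine ⟨{⟨r, hr⟩, ⟨s, hs⟩, ⟨t, ht⟩}, ⟨(isCircuit_triple_iff hrs' hst').2 ?_, ?_⟩, ?_⟩
  · simp [hrv, hsv, htv, ← er, ← er', ← es, ← es', ← et, ← et', e1, e2, e3]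
  · intro T' hT' hc
    have hcard : T'.card < 3 := by
      have := Finset.card_lt_card hT'
      rwa [Finset.card_eq_three.2 ⟨_, _, _, hrs'.ne, hrt'.ne, hst'.ne, rfl⟩] at this
    have : T'.card = 1 ∨ T'.card = 2 := by have := hc.1.card_pos; omega
    rcases this with h | h
    · obtain ⟨x, rfl⟩ := Finset.card_eq_one.1 h
      exact not_isCircuit_singleton (hL.getElem x.2).2 hc
    · obtain ⟨x, y, hxy, rfl⟩ := Finset.card_eq_two.1 h
      wlog hlt : x < y generalizing x y
      · exact this y x hxy.symm (by rwa [Finset.pair_comm]) (by rwa [Finset.pair_comm])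
          (by rwa [Finset.pair_comm]) (by rwa [Finset.pair_comm])
          (lt_of_le_of_ne (not_lt.1 hlt) hxy.symm)
      obtain ⟨-, -, c1, c2⟩ := (isCircuit_pair_iff hlt).1 hc
      have hx := hT'.subset (Finset.mem_insert_self x {y})
      have hy := hT'.subset (Finset.mem_insert_of_mem (Finset.mem_singleton_self y) : y ∈ {x, y})
      simp only [Finset.mem_insert, Finset.mem_singleton] at hx hy
      simp only [List.get_eq_getElem] at c1 c2
      rcases hx with rfl | rfl | rfl <;> rcases hy with rfl | rfl | rfl
      · exact hlt.false
      · exact h3 (by rw [← e2, es', c2, er])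
      · exact h2 (by rw [← e1, er', c1, et])
      · exact lt_asymm hlt hrs'
      · exact hlt.false
      · exact h1 (by rw [← e3, et', c2, es])
      · exact lt_asymm hlt hrt'
      · exact lt_asymm hlt hst'
      · exact hlt.false
  · intro u hu
    rw [kPval, Finset.sum_insert (by simp [hrs.ne, (hrs.trans hst).ne]), Finset.sum_pair hst'.ne,
      kM_eq_moveGain hL hu _ hrv, kM_eq_moveGain hL hu _ hsv, kM_eq_moveGain hL hu _ htv]
    simp [e1, e2, e3, add_assoc]

end Vertices

section Walks

lemma exists_step_of_not_of {P : ℕ → Prop} {s t : ℕ} (hst : s ≤ t) (hs : ¬ P s) (ht : P t) :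
    ∃ r, s ≤ r ∧ r < t ∧ ¬ P r ∧ P (r + 1) := by
  induction t, hst using Nat.le_induction with
  | base => exact absurd ht hs
  | succ t hst ih =>
    by_cases h : P t
    · obtain ⟨r, h1, h2, h3⟩ := ih h
      exact ⟨r, h1, by omega, h3⟩
    · exact ⟨t, hst, by omega, h, ht⟩

lemma exists_step_ne {α : Type*} {f : ℕ → α} {s t : ℕ} (hst : s ≤ t) (h : f s ≠ f t) :
    ∃ r, s ≤ r ∧ r < t ∧ f r ≠ f (r + 1) := by
  obtain ⟨r, h1, h2, h3, h4⟩ := exists_step_of_not_of (P := fun r => f r = f t) hst h rfl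
  exact ⟨r, h1, h2, fun h => h3 (h.trans h4)⟩

lemma fin_three_eq_of_ne : ∀ {a b x y : Fin 3}, a ≠ b → x ≠ a → x ≠ b → y ≠ a → y ≠ b →
    x = y := by decide

/-- A walk `V` on three parts, with a monotone level `c` that jumps in each of three gaps
`(r₁, s₂)`, `(r₂, s₃)`, `(r₃, s₄)` between consecutive moves and is constant on `[s₂, r₂]` and on
`[s₃, r₃]`, either has two inverse moves at different levels, or a rotation whose last two moves
only have the same level, or four rotating moves of which the first two have different levels. -/
lemma exists_rotation {V : ℕ → Fin 3} {c : ℕ → ℕ} (hc : Monotone c)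
    {r₁ s₂ r₂ s₃ r₃ s₄ : ℕ} (h12 : r₁ < s₂) (h2 : s₂ ≤ r₂) (h23 : r₂ < s₃) (h3 : s₃ ≤ r₃)
    (h34 : r₃ < s₄)
    (m₁ : V r₁ ≠ V (r₁ + 1)) (m₂ : V s₂ ≠ V (s₂ + 1)) (n₂ : V r₂ ≠ V (r₂ + 1))
    (m₃ : V s₃ ≠ V (s₃ + 1)) (n₃ : V r₃ ≠ V (r₃ + 1)) (m₄ : V s₄ ≠ V (s₄ + 1))
    (g₁ : V (r₁ + 1) = V s₂) (g₂ : V (r₂ + 1) = V s₃) (g₃ : V (r₃ + 1) = V s₄)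
    (c12 : c r₁ < c s₂) (c2 : c s₂ = c r₂) (c23 : c r₂ < c s₃) (c3 : c s₃ = c r₃)
    (c34 : c r₃ < c s₄) :
    (∃ s t, r₁ ≤ s ∧ s < t ∧ t ≤ s₄ ∧ c s < c t ∧ V s ≠ V (s + 1) ∧ V t = V (s + 1) ∧
      V (t + 1) = V s) ∨
    (∃ r s t, r₁ ≤ r ∧ r < s ∧ s < t ∧ t ≤ s₄ ∧ c r < c s ∧ c s = c t ∧
      V r ≠ V s ∧ V s ≠ V t ∧ V t ≠ V r ∧
      V (r + 1) = V s ∧ V (s + 1) = V t ∧ V (t + 1) = V r) ∨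
    (∃ q r s t, r₁ ≤ q ∧ q < r ∧ r < s ∧ s < t ∧ t ≤ s₄ ∧ c q < c r ∧
      V q ≠ V r ∧ V r ≠ V s ∧ V s ≠ V q ∧
      V (q + 1) = V r ∧ V (r + 1) = V s ∧ V (s + 1) = V q ∧ V t = V q ∧ V (t + 1) = V r) := by
  rw [or_iff_not_imp_left, or_iff_not_imp_left]
  intro inv rot
  -- no two moves at different levels are inverse
  have inv' : ∀ s t, r₁ ≤ s → t ≤ s₄ → c s < c t → V s ≠ V (s + 1) → V t = V (s + 1) →
      V (t + 1) ≠ V s := fun s t h h' hct h1 h2 h3 =>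
    inv ⟨s, t, h, hc.reflect_lt hct, h', hct, h1, h2, h3⟩
  set a := V r₁ with ha
  set b := V (r₁ + 1) with hb
  have hab : a ≠ b := m₁
  have e1 : V s₂ = b := g₁.symm
  set d := V (s₂ + 1) with hd
  have hbd : b ≠ d := by rw [← e1]; exact m₂
  have hda : d ≠ a := inv' r₁ s₂ le_rfl (by omega) c12 m₁ e1
  -- the part `a` is not reached within the second block
  have noa : ∀ t, s₂ < t → t ≤ r₂ + 1 → V t ≠ a := by
    intro t ht ht' hta
    obtain ⟨j, hj1, hj2, hj3, hj4⟩ :=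
      exists_step_of_not_of (P := fun j => V j = a) (show s₂ + 1 ≤ t from ht) hda hta
    have hcj : c s₂ = c j := le_antisymm (hc (by omega)) (c2 ▸ hc (by omega))
    have hjb : V j ≠ b := fun h => inv' r₁ j le_rfl (by omega) (hcj ▸ c12) m₁ h hj4
    have hjd : V j = d := fin_three_eq_of_ne hab hj3 hjb hda hbd.symm
    exact rot ⟨r₁, s₂, j, le_rfl, h12, by omega, by omega, c12, hcj, by rw [e1]; exact m₁,
      by rw [e1, hjd]; exact hbd, by rw [hjd]; exact hda, e1.symm, hjd.symm, hj4⟩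
  have f1 : V (r₂ + 1) = d := by
    by_contra hne
    have hra := noa (r₂ + 1) (by omega) le_rfl
    have hrb : V (r₂ + 1) = b := fin_three_eq_of_ne hda hne hra hbd hab.symm
    have hs : V s₃ = b := g₂ ▸ hrb
    have hsa : V (s₃ + 1) ≠ a :=
      inv' r₁ s₃ le_rfl (by omega) (c12.trans (c2 ▸ c23)) m₁ hs
    have hsd : V (s₃ + 1) = d :=
      fin_three_eq_of_ne hab hsa (by rw [← hs]; exact m₃.symm) hda hbd.symm
    have hne' : s₂ ≠ r₂ := by rintro rfl; exact hne rfl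
    have hrd : V r₂ = d := fin_three_eq_of_ne hab (noa r₂ (by omega) (by omega))
      (by rw [← hrb]; exact n₂) hda hbd.symm
    exact inv' r₂ s₃ (by omega) (by omega) c23 n₂ g₂.symm (hsd.trans hrd.symm)
  have f2 : V r₂ = b := by
    by_cases h : s₂ = r₂
    · rw [← h, e1]
    · exact fin_three_eq_of_ne hda (by rw [← f1]; exact n₂) (noa r₂ (by omega) (by omega)) hbd
        hab.symm
  have f3 : V s₃ = d := g₂ ▸ f1
  have f4 : V (s₃ + 1) = a := by
    refine fin_three_eq_of_ne hbd ?_ (by rw [← f3]; exact m₃.symm) hab hda.symm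
    rw [← f2]
    exact inv' r₂ s₃ (by omega) (by omega) c23 n₂ g₂.symm
  -- the part `b` is not reached within the third block
  have nob : ∀ t, s₃ < t → t ≤ r₃ + 1 → V t ≠ b := by
    intro t ht ht' htb
    obtain ⟨j, hj1, hj2, hj3, hj4⟩ := exists_step_of_not_of (P := fun j => V j = b)
      (show s₃ + 1 ≤ t from ht) (by rw [f4]; exact hab) htb
    have hcj : c s₃ = c j := le_antisymm (hc (by omega)) (c3 ▸ hc (by omega))
    have hjd : V j ≠ d := fun h => inv' r₂ j (by omega) (by omega) (hcj ▸ c23) n₂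
      (h.trans f1.symm) (hj4.trans f2.symm)
    have hja : V j = a := fin_three_eq_of_ne hbd hj3 hjd hab hda.symm
    exact rot ⟨r₂, s₃, j, by omega, h23, by omega, by omega, c23, hcj, by rw [f2, f3]; exact hbd,
      by rw [f3, hja]; exact hda, by rw [hja, f2]; exact hab, g₂, f4.trans hja.symm,
      hj4.trans f2.symm⟩
  have k1 : V (r₃ + 1) = a := by
    by_contra hne
    have hrb := nob (r₃ + 1) (by omega) le_rfl
    have hrd : V (r₃ + 1) = d := fin_three_eq_of_ne hab hne hrb hda hbd.symm
    have hs : V s₄ = d := g₃ ▸ hrd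
    have hsb : V (s₄ + 1) ≠ b := by
      rw [← f2]
      exact inv' r₂ s₄ (by omega) le_rfl (c23.trans (c3 ▸ c34)) n₂ (hs.trans f1.symm)
    have hsa : V (s₄ + 1) = a :=
      fin_three_eq_of_ne hbd hsb (by rw [← hs]; exact m₄.symm) hab hda.symm
    have hne' : s₃ ≠ r₃ := by rintro rfl; exact hne f4
    have hra : V r₃ = a := fin_three_eq_of_ne hbd (nob r₃ (by omega) (by omega))
      (by rw [← hrd]; exact n₃) hab hda.symm
    exact inv' r₃ s₄ (by omega) le_rfl c34 n₃ g₃.symm (hsa.trans hra.symm)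
  have k2 : V r₃ = d := by
    by_cases h : s₃ = r₃
    · rw [← h, f3]
    · exact fin_three_eq_of_ne hab (by rw [← k1]; exact n₃) (nob r₃ (by omega) (by omega)) hda
        hbd.symm
  have k3 : V s₄ = a := g₃ ▸ k1
  have k4 : V (s₄ + 1) = b := by
    refine fin_three_eq_of_ne hda ?_ (by rw [← k3]; exact m₄.symm) hbd hab.symm
    rw [← k2]
    exact inv' r₃ s₄ (by omega) le_rfl c34 n₃ g₃.symm
  refine ⟨r₁, r₂, s₃, s₄, le_rfl, by omega, h23, by omega, le_rfl, c2 ▸ c12, ?_, ?_, ?_, ?_, ?_,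
    ?_, ?_, ?_⟩
  · rw [f2]; exact hab
  · rw [f2, f3]; exact hbd
  · rw [f3]; exact hda
  · rw [f2]
  · exact g₂
  · exact f4
  · exact k3
  · rw [f2]; exact k4

/-- The levels of a monotone `c` on a finite set `S` split `S` into consecutive runs
`[F r, E r]`. -/
lemma exists_level_runs {c : ℕ → ℕ} (hc : Monotone c) (S : Finset ℕ) :
    ∃ F E : ℕ → ℕ, (∀ r < (S.image c).card, F r ∈ S ∧ E r ∈ S ∧ F r ≤ E r ∧ c (F r) = c (E r)) ∧
      ∀ r, r + 1 < (S.image c).card → E r < F (r + 1) ∧ c (E r) < c (F (r + 1)) ∧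
        ∀ s ∈ S, s ≤ E r ∨ F (r + 1) ≤ s := by
  set b := (S.image c).card with hb
  let l : Fin b ↪o ℕ := (S.image c).orderEmbOfFin rfl
  have hl : ∀ r : Fin b, ∃ f e, f ∈ S ∧ e ∈ S ∧ c f = l r ∧ c e = l r ∧
      ∀ s ∈ S, c s = l r → f ≤ s ∧ s ≤ e := by
    intro r
    obtain ⟨x, hx, hxr⟩ := Finset.mem_image.1 ((S.image c).orderEmbOfFin_mem rfl r)
    have hne : (S.filter (fun s => c s = l r)).Nonempty := ⟨x, by simp [hx, hxr, l]⟩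
    have h1 := Finset.mem_filter.1 (Finset.min'_mem _ hne)
    have h2 := Finset.mem_filter.1 (Finset.max'_mem _ hne)
    refine ⟨_, _, h1.1, h2.1, h1.2, h2.2, fun s hs hsr => ?_⟩
    have : s ∈ S.filter (fun s => c s = l r) := by simp [hs, hsr]
    exact ⟨Finset.min'_le _ _ this, Finset.le_max' _ _ this⟩
  choose f e hf he hcf hce hfe using hl
  refine ⟨fun r => if h : r < b then f ⟨r, h⟩ else 0, fun r => if h : r < b then e ⟨r, h⟩ else 0,
    fun r hr => ?_, fun r hr => ?_⟩
  · simp only [hr, dif_pos]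
    exact ⟨hf _, he _, (hfe _ _ (he _) (hce _)).1, by rw [hcf, hce]⟩
  · have hr' : r < b := by omega
    simp only [hr, hr', dif_pos]
    have hlt : c (e ⟨r, hr'⟩) < c (f ⟨r + 1, hr⟩) := by
      rw [hce, hcf]
      exact l.strictMono (Fin.mk_lt_mk.2 (by omega))
    refine ⟨hc.reflect_lt hlt, hlt, fun s hs => ?_⟩
    by_contra! hcon
    have hmem : c s ∈ Set.range l := by
      rw [Finset.range_orderEmbOfFin]
      exact Finset.mem_coe.2 (Finset.mem_image_of_mem c hs)
    obtain ⟨i, hi⟩ := hmem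
    have h1 : l ⟨r, hr'⟩ ≤ l i := by rw [hi, ← hce]; exact hc hcon.1.le
    have h2 : l i ≤ l ⟨r + 1, hr⟩ := by rw [hi, ← hcf]; exact hc hcon.2.le
    rw [l.le_iff_le, Fin.le_def] at h1 h2
    have h3 : i = ⟨r, hr'⟩ ∨ i = ⟨r + 1, hr⟩ := by
      simp only [Fin.ext_iff] at *
      omega
    rcases h3 with rfl | rfl
    · exact absurd (hfe _ s hs hi.symm).2 (by omega)
    · exact absurd (hfe _ s hs hi.symm).1 (by omega)

end Walks

section Acyclic

variable {n : ℕ} {L : List (KMove n 3)} {τ : Fin n → Fin 3}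

/-- An acyclic vertex never returns to a part it has left. -/
lemma eq_of_notMem_cyclicSet (hL : kValid τ L) {u : Fin n} (hu : u ∉ cyclicSet L) {r s t : ℕ}
    (hrs : r ≤ s) (hst : s ≤ t) (h : kConfAt τ L r u = kConfAt τ L t u) :
    kConfAt τ L s u = kConfAt τ L r u := by
  have hu' : ∀ T, ¬ IsCycle L u T := by simpa [cyclicSet] using hu
  by_contra hne
  set X : ℕ → Fin 3 := fun t => kConfAt τ L t u with hX
  obtain ⟨d, hd1, hd2, hd3, hd4⟩ :=
    exists_step_of_not_of (P := fun j => X j ≠ X r) hrs (by simp) hne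
  rw [not_not] at hd3
  have hex : ∃ e, d < e ∧ X e = X r := ⟨t, by omega, h.symm⟩
  obtain ⟨he1, he2⟩ := Nat.find_spec hex
  have hmin := fun m => Nat.find_min (m := m) hex
  obtain ⟨m, hm⟩ : ∃ m, Nat.find hex = m + 1 := ⟨Nat.find hex - 1, by omega⟩
  rw [hm] at he1 he2 hmin
  have hdm : d < m := by
    refine lt_of_le_of_ne (by omega) ?_
    rintro rfl
    exact hd4 he2
  have hne' : ∀ j, d < j → j ≤ m → X j ≠ X r := fun j h1 h2 h3 => hmin j (by omega) ⟨h1, h3⟩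
  by_cases hmd : X m = X (d + 1)
  · obtain ⟨T, hT, -⟩ := exists_cycle_two hL u hdm (show X d ≠ X (d + 1) by rw [hd3]; exact hd4.symm)
      hmd (he2.trans hd3.symm)
    exact hu' T hT
  · obtain ⟨j, hj1, hj2, hj3, hj4⟩ := exists_step_of_not_of (P := fun j => X j = X m)
      (show d + 1 ≤ m from hdm) (Ne.symm hmd) rfl
    have hjr := hne' j (by omega) (by omega)
    have hmr := hne' m hdm le_rfl
    have hj : X (d + 1) = X j := fin_three_eq_of_ne hmr (Ne.symm hmd) hd4 hj3 hjr
    obtain ⟨T, hT, -⟩ := exists_cycle_three hL u (show d < j by omega) hj2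
      (show X d ≠ X j by rw [hd3]; exact hjr.symm) hj3 (show X m ≠ X d by rw [hd3]; exact hmr)
      hj hj4 (he2.trans hd3.symm)
    exact hu' T hT

/-- The number of moves of acyclic vertices before time `t`. -/
noncomputable def acyclicCount (L : List (KMove n 3)) (t : ℕ) : ℕ :=
  Nat.count (fun d => ¬ cycPos L d) t

lemma acyclicCount_monotone (L : List (KMove n 3)) : Monotone (acyclicCount L) :=
  Nat.count_monotone _

lemma cycPos_of_acyclicCount_eq {s d t : ℕ} (h : acyclicCount L s = acyclicCount L t)
    (hsd : s ≤ d) (hdt : d < t) : cycPos L d := by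
  by_contra hd
  have h1 : acyclicCount L (d + 1) = acyclicCount L d + 1 := by
    simp [acyclicCount, Nat.count_succ, hd]
  have h2 := acyclicCount_monotone L hsd
  have h3 := acyclicCount_monotone L (show d + 1 ≤ t from hdt)
  omega

lemma exists_not_cycPos {s t : ℕ} (h : acyclicCount L s < acyclicCount L t) :
    ∃ d, s ≤ d ∧ d < t ∧ ¬ cycPos L d := by
  by_contra! hcon
  have hst : s ≤ t := ((acyclicCount_monotone L).reflect_lt h).le
  have : ∀ d, s ≤ d → d ≤ t → acyclicCount L d = acyclicCount L s := by
    intro d hd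
    induction d, hd using Nat.le_induction with
    | base => simp
    | succ d hd ih =>
      intro hdt
      rw [← ih (by omega), acyclicCount, Nat.count_succ, acyclicCount]
      simp [hcon d hd (by omega)]
  have := this t hst le_rfl
  omega

lemma acyclic_eq_of_acyclicCount_eq (hL : kValid τ L) {u : Fin n} (hu : u ∉ cyclicSet L)
    {s t : ℕ} (hst : s ≤ t) (h : acyclicCount L s = acyclicCount L t) :
    kConfAt τ L s u = kConfAt τ L t u := by
  by_contra hne
  obtain ⟨d, hd1, hd2, hd3⟩ := exists_step_ne (f := fun t => kConfAt τ L t u) hst hne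
  obtain ⟨hd, hdu⟩ := (hL.moves_iff u d).1 hd3
  obtain ⟨m, hm, hmc⟩ := cycPos_of_acyclicCount_eq h hd1 hd2
  rw [List.getElem?_eq_getElem hd, Option.some_inj] at hm
  rw [← hm, hdu] at hmc
  exact hu hmc

lemma exists_acyclic_ne (hL : kValid τ L) {s t : ℕ} (ht : t < L.length)
    (h : acyclicCount L s < acyclicCount L t) :
    ∃ u ∈ acyclicSet L, kConfAt τ L s u ≠ kConfAt τ L t u := by
  obtain ⟨d, hd1, hd2, hd3⟩ := exists_not_cycPos h
  have hd : d < L.length := by omega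
  have hu : L[d].1 ∉ cyclicSet L := fun hc => hd3 ⟨L[d], List.getElem?_eq_getElem hd, hc⟩
  refine ⟨L[d].1, ?_, fun heq => ?_⟩
  · rw [acyclicSet, Finset.mem_sdiff]
    exact ⟨List.mem_toFinset.2 (List.mem_map_of_mem (List.getElem_mem hd)), hu⟩
  · have h1 := eq_of_notMem_cyclicSet hL hu hd1 hd2.le heq
    have h2 := eq_of_notMem_cyclicSet hL hu (hd1.trans (Nat.le_succ d)) hd2 heq
    exact (hL.moves_iff _ d).2 ⟨hd, rfl⟩ (h1.trans h2.symm)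

/-- The number of cyclic blocks containing `v` is at most the number of values of `acyclicCount`
at the moves of `v`. -/
lemma bL_le_card_image (L : List (KMove n 3)) {v : Fin n} {S : Finset ℕ}
    (hS : ∀ t m, L[t]? = some m → m.1 = v → t ∈ S) :
    bL L v ≤ (S.image (acyclicCount L)).card := by
  refine Finset.card_le_card_of_injOn (fun p => acyclicCount L p.1) ?_ ?_
  · rintro ⟨i, j⟩ hp
    obtain ⟨-, ⟨-, -, hij, -, -⟩, t, hit, htj, m, hm, hmv⟩ := Finset.mem_filter.1 hp
    refine Finset.mem_coe.2 (Finset.mem_image.2 ⟨t, hS t m hm hmv, ?_⟩)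
    by_contra hne
    have hlt := lt_of_le_of_ne (acyclicCount_monotone L hit) (Ne.symm hne)
    obtain ⟨d, hd1, hd2, hd3⟩ := exists_not_cycPos hlt
    exact hd3 (hij d hd1 (hd2.le.trans htj))
  · have key : ∀ i i' j', IsCycBlock L i' j' → acyclicCount L i = acyclicCount L i' →
        ¬ i < i' := by
      rintro i i' j' ⟨-, -, -, h4, -⟩ heq hlt
      rcases h4 with h4 | h4
      · omega
      · exact h4 (cycPos_of_acyclicCount_eq heq (by omega) (by omega))
    have key' : ∀ i j j', IsCycBlock L i j → IsCycBlock L i j' → ¬ j < j' := by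
      rintro i j j' ⟨h1, -, -, -, h5⟩ ⟨-, -, h3, -, -⟩ hlt
      exact h5 (h3 (j + 1) (by omega) hlt)
    rintro ⟨i, j⟩ hp ⟨i', j'⟩ hp' heq
    have hb := (Finset.mem_filter.1 hp).2.1
    have hb' := (Finset.mem_filter.1 hp').2.1
    simp only at heq hb hb'
    obtain rfl : i = i' :=
      le_antisymm (not_lt.1 (key _ _ _ hb heq.symm)) (not_lt.1 (key _ _ _ hb' heq))
    obtain rfl : j = j' :=
      le_antisymm (not_lt.1 (key' _ _ _ hb' hb)) (not_lt.1 (key' _ _ _ hb hb'))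
    rfl

end Acyclic

section GoodArcs

variable {n : ℕ} {L : List (KMove n 3)} {τ : Fin n → Fin 3}

lemma ne_of_mem_acyclicSet {u v : Fin n} (hu : u ∈ acyclicSet L) (hv : v ∈ cyclicSet L) :
    u ≠ v := by
  rintro rfl
  exact (Finset.mem_sdiff.1 hu).2 hv

/-- Every window of moves of `v` spanning three acyclic gaps supports a cycle over `v` with a good
arc to an acyclic vertex, and its good arcs only lead to vertices moving inside the window. -/
lemma exists_cycle_goodArc (hL : kValid τ L) {v : Fin n} (hv : v ∈ cyclicSet L)
    {r₁ s₂ r₂ s₃ r₃ s₄ : ℕ} (h12 : r₁ < s₂) (h2 : s₂ ≤ r₂) (h23 : r₂ < s₃) (h3 : s₃ ≤ r₃)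
    (h34 : r₃ < s₄)
    (m₁ : kConfAt τ L r₁ v ≠ kConfAt τ L (r₁ + 1) v)
    (m₂ : kConfAt τ L s₂ v ≠ kConfAt τ L (s₂ + 1) v)
    (n₂ : kConfAt τ L r₂ v ≠ kConfAt τ L (r₂ + 1) v)
    (m₃ : kConfAt τ L s₃ v ≠ kConfAt τ L (s₃ + 1) v)
    (n₃ : kConfAt τ L r₃ v ≠ kConfAt τ L (r₃ + 1) v)
    (m₄ : kConfAt τ L s₄ v ≠ kConfAt τ L (s₄ + 1) v)
    (g₁ : kConfAt τ L (r₁ + 1) v = kConfAt τ L s₂ v)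
    (g₂ : kConfAt τ L (r₂ + 1) v = kConfAt τ L s₃ v)
    (g₃ : kConfAt τ L (r₃ + 1) v = kConfAt τ L s₄ v)
    (c12 : acyclicCount L r₁ < acyclicCount L s₂) (c2 : acyclicCount L s₂ = acyclicCount L r₂)
    (c23 : acyclicCount L r₂ < acyclicCount L s₃) (c3 : acyclicCount L s₃ = acyclicCount L r₃)
    (c34 : acyclicCount L r₃ < acyclicCount L s₄) :
    ∃ T, IsCycle L v T ∧ (∃ u ∈ acyclicSet L, kPval L τ v u T ≠ 0) ∧
      ∀ u, u ≠ v → kPval L τ v u T ≠ 0 →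
        ∃ d, r₁ ≤ d ∧ d < s₄ ∧ kConfAt τ L d u ≠ kConfAt τ L (d + 1) u := by
  have hlen : s₄ < L.length := ((hL.moves_iff v s₄).1 m₄).1
  have hstep : ∀ u, (¬ ∃ d, r₁ ≤ d ∧ d < s₄ ∧ kConfAt τ L d u ≠ kConfAt τ L (d + 1) u) →
      ∀ t, r₁ ≤ t → t ≤ s₄ → kConfAt τ L t u = kConfAt τ L r₁ u := by
    intro u hu t ht ht'
    by_contra hne
    obtain ⟨d, hd1, hd2, hd3⟩ :=
      exists_step_ne (f := fun t => kConfAt τ L t u) ht (Ne.symm hne)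
    exact hu ⟨d, hd1, by omega, hd3⟩
  have three : ∀ {r s t : ℕ}, r₁ ≤ r → r < s → s < t → t ≤ s₄ →
      kConfAt τ L r v ≠ kConfAt τ L s v → kConfAt τ L s v ≠ kConfAt τ L t v →
      kConfAt τ L t v ≠ kConfAt τ L r v → kConfAt τ L (r + 1) v = kConfAt τ L s v →
      kConfAt τ L (s + 1) v = kConfAt τ L t v → kConfAt τ L (t + 1) v = kConfAt τ L r v →
      ∃ T, IsCycle L v T ∧ (∀ u ∈ acyclicSet L, kConfAt τ L r u ≠ kConfAt τ L s u →
        kConfAt τ L s u = kConfAt τ L t u → kPval L τ v u T ≠ 0) ∧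
      ∀ u, u ≠ v → kPval L τ v u T ≠ 0 →
        ∃ d, r₁ ≤ d ∧ d < s₄ ∧ kConfAt τ L d u ≠ kConfAt τ L (d + 1) u := by
    intro r s t hr hrs hst ht a1 a2 a3 b1 b2 b3
    obtain ⟨T, hT, hP⟩ := exists_cycle_three hL v hrs hst a1 a2 a3 b1 b2 b3
    refine ⟨T, hT, fun u hu hne heq => ?_, fun u hu hne => ?_⟩
    · rw [hP u (ne_of_mem_acyclicSet hu hv), ← heq, Int.cast_ne_zero]
      exact moveGain_three_ne_zero _ _ _ _ _ a1 a2 a3 hne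
    · by_contra hcon
      have hc := hstep u hcon
      rw [hP u hu, hc r hr (by omega), hc s (by omega) (by omega), hc t (by omega) ht,
        moveGain_three_const _ _ _ _ a1 a2 a3] at hne
      exact hne Int.cast_zero
  rcases exists_rotation (V := fun t => kConfAt τ L t v) (acyclicCount_monotone L) h12 h2 h23 h3
    h34 m₁ m₂ n₂ m₃ n₃ m₄ g₁ g₂ g₃ c12 c2 c23 c3 c34 with
    ⟨s, t, hs, hst, ht, hc, a1, a2, a3⟩ |
    ⟨r, s, t, hr, hrs, hst, ht, hc, hc', a1, a2, a3, b1, b2, b3⟩ |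
    ⟨q, r, s, t, hq, hqr, hrs, hst, ht, hc, a1, a2, a3, b1, b2, b3, b4, b5⟩
  · obtain ⟨T, hT, hP⟩ := exists_cycle_two hL v hst a1 a2 a3
    have hne' : kConfAt τ L s v ≠ kConfAt τ L t v := fun h => a1 (h.trans a2)
    obtain ⟨u, hu, hux⟩ := exists_acyclic_ne hL (by omega) hc
    refine ⟨T, hT, ⟨u, hu, ?_⟩, fun w hw hne => ?_⟩
    · rw [hP u (ne_of_mem_acyclicSet hu hv), Int.cast_ne_zero]
      exact moveGain_two_ne_zero _ _ _ _ hne' hux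
    · by_contra hcon
      have hc := hstep w hcon
      rw [hP w hw, hc s hs (by omega), hc t (by omega) ht,
        moveGain_two_const _ _ _ hne'] at hne
      exact hne Int.cast_zero
  · obtain ⟨T, hT, hP, hd⟩ := three hr hrs hst ht a1 a2 a3 b1 b2 b3
    obtain ⟨u, hu, hux⟩ := exists_acyclic_ne hL (by omega) hc
    exact ⟨T, hT, ⟨u, hu, hP u hu hux
      (acyclic_eq_of_acyclicCount_eq hL (Finset.mem_sdiff.1 hu).2 hst.le hc')⟩, hd⟩
  · obtain ⟨u, hu, hux⟩ := exists_acyclic_ne hL (by omega) hc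
    have hu' := (Finset.mem_sdiff.1 hu).2
    by_cases hx : kConfAt τ L r u = kConfAt τ L s u
    · obtain ⟨T, hT, hP, hd⟩ := three hq hqr hrs (by omega) a1 a2 a3 b1 b2 b3
      exact ⟨T, hT, ⟨u, hu, hP u hu hux hx⟩, hd⟩
    · obtain ⟨T, hT, hP, hd⟩ := three (hq.trans hqr.le) hrs hst ht a2 (by simpa [b4] using a3)
        (by simpa [b4] using a1) b2 (b3.trans b4.symm) b5
      refine ⟨T, hT, ⟨u, hu, hP u hu hx ?_⟩, hd⟩
      refine fin_three_eq_of_ne hux ?_ (Ne.symm hx) ?_ ?_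
      · exact fun h => hux (eq_of_notMem_cyclicSet hL hu' hqr.le hrs.le h.symm).symm
      · exact fun h => hux
          (eq_of_notMem_cyclicSet hL hu' hqr.le (hrs.trans hst).le h.symm).symm
      · exact fun h => hx (eq_of_notMem_cyclicSet hL hu' hrs.le hst.le h.symm).symm

/-- An acyclic vertex moves inside at most two of a family of disjoint time windows. -/
lemma card_windows_le_two (hL : kValid τ L) {u : Fin n} (hu : u ∉ cyclicSet L) {ι : Type*}
    [LinearOrder ι] {a b : ι → ℕ} (hab : ∀ i j, i < j → b i ≤ a j) (I : Finset ι)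
    (hI : ∀ i ∈ I, ∃ d, a i ≤ d ∧ d < b i ∧ kConfAt τ L d u ≠ kConfAt τ L (d + 1) u) :
    I.card ≤ 2 := by
  choose! d hd1 hd2 hd3 using hI
  have hlt : ∀ i ∈ I, ∀ j ∈ I, i < j →
      kConfAt τ L (d i + 1) u ≠ kConfAt τ L (d j + 1) u := by
    intro i hi j hj hij h
    have hdd : d i + 1 ≤ d j := (hd2 i hi).trans_le ((hab i j hij).trans (hd1 j hj))
    have := eq_of_notMem_cyclicSet hL hu hdd (Nat.le_succ _) h
    exact hd3 j hj (this.trans h)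
  have hcard : I.card ≤ (Finset.univ.erase (kConfAt τ L 0 u)).card := by
    refine Finset.card_le_card_of_injOn (fun i => kConfAt τ L (d i + 1) u) ?_ ?_
    · intro i hi
      refine Finset.mem_coe.2 (Finset.mem_erase.2 ⟨fun h => ?_, Finset.mem_univ _⟩)
      have := eq_of_notMem_cyclicSet hL hu (Nat.zero_le _) (Nat.le_succ (d i)) h.symm
      exact hd3 i hi (this.trans h.symm)
    · intro i hi j hj hij
      rcases lt_trichotomy i j with h | h | h
      · exact absurd hij (hlt i hi j hj h)
      · exact h
      · exact absurd hij.symm (hlt j hj i hi h)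
  simpa using hcard

/-- If every `i` is related to an element of `A`, and every element of `A` to at most two `i`,
then at least half as many elements of `A` have private partners. -/
lemma exists_private_partners {α ι : Type*} [Fintype ι] (A : Finset α)
    (R : α → ι → Prop) (hcov : ∀ i, ∃ u ∈ A, R u i)
    (htwo : ∀ u ∈ A, ∀ I : Finset ι, (∀ i ∈ I, R u i) → I.card ≤ 2) :
    ∃ U ⊆ A, Fintype.card ι ≤ 2 * U.card ∧
      ∀ u ∈ U, ∃ i, R u i ∧ ∀ w ∈ U, w ≠ u → ¬ R w i := by
  have hne : (A.powerset.filter (fun U => ∀ i, ∃ u ∈ U, R u i)).Nonempty :=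
    ⟨A, by simpa using hcov⟩
  obtain ⟨U, hU, hmin⟩ := Finset.exists_min_image _ Finset.card hne
  obtain ⟨hUA, hUcov⟩ := Finset.mem_filter.1 hU
  rw [Finset.mem_powerset] at hUA
  refine ⟨U, hUA, ?_, fun u hu => ?_⟩
  · calc Fintype.card ι = (Finset.univ : Finset ι).card := rfl
      _ ≤ (U.biUnion fun u => Finset.univ.filter (R u)).card := by
        refine Finset.card_le_card fun i _ => ?_
        simpa using hUcov i
      _ ≤ U.card * 2 := Finset.card_biUnion_le_card_mul _ _ _ fun u hu =>
        htwo u (hUA hu) _ fun i hi => (Finset.mem_filter.1 hi).2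
      _ = 2 * U.card := mul_comm _ _
  · have hnot : ¬ ∀ i, ∃ w ∈ U.erase u, R w i := fun h =>
      absurd (hmin (U.erase u) (Finset.mem_filter.2
        ⟨Finset.mem_powerset.2 ((Finset.erase_subset _ _).trans hUA), h⟩))
        (not_le.2 (Finset.card_erase_lt_of_mem hu))
    push Not at hnot
    obtain ⟨i, hi⟩ := hnot
    obtain ⟨w, hw, hwi⟩ := hUcov i
    refine ⟨i, ?_, fun w hw hwu => hi w (Finset.mem_erase.2 ⟨hwu, hw⟩)⟩
    by_cases hwu : w = u
    · exact hwu ▸ hwi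
    · exact absurd hwi (hi w (Finset.mem_erase.2 ⟨hwu, hw⟩))

/-- There are `(b_L(v) - 1) / 3` cycles over `v` in disjoint time windows, each with a good arc to
an acyclic vertex. -/
lemma exists_window_cycles (hL : kValid τ L) {v : Fin n} (hv : v ∈ cyclicSet L) :
    ∃ (a b : Fin ((bL L v - 1) / 3) → ℕ)
      (T : Fin ((bL L v - 1) / 3) → Finset (Fin L.length)),
      (∀ i j, i < j → b i ≤ a j) ∧ ∀ i, IsCycle L v (T i) ∧
        (∃ u ∈ acyclicSet L, kPval L τ v u (T i) ≠ 0) ∧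
        ∀ u, u ≠ v → kPval L τ v u (T i) ≠ 0 →
          ∃ d, a i ≤ d ∧ d < b i ∧ kConfAt τ L d u ≠ kConfAt τ L (d + 1) u := by
  set S : Finset ℕ := (Finset.range L.length).filter
    (fun t => kConfAt τ L t v ≠ kConfAt τ L (t + 1) v) with hS
  have hmem : ∀ t, t ∈ S ↔ kConfAt τ L t v ≠ kConfAt τ L (t + 1) v := fun t => by
    simp only [hS, Finset.mem_filter, Finset.mem_range, and_iff_right_iff_imp]
    exact fun h => ((hL.moves_iff v t).1 h).1
  have hb := bL_le_card_image L (v := v) (S := S) fun t m hm hmv => by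
    obtain ⟨ht, rfl⟩ := List.getElem?_eq_some_iff.1 hm
    exact (hmem t).2 ((hL.moves_iff v t).2 ⟨ht, hmv⟩)
  obtain ⟨F, E, hFE, hgap⟩ := exists_level_runs (acyclicCount_monotone L) S
  set N := (S.image (acyclicCount L)).card
  have hcons : ∀ r, r + 1 < N → kConfAt τ L (E r + 1) v = kConfAt τ L (F (r + 1)) v := by
    intro r hr
    obtain ⟨h1, -, h3⟩ := hgap r hr
    by_contra hne
    obtain ⟨d, hd1, hd2, hd3⟩ := exists_step_ne (f := fun t => kConfAt τ L t v) h1 hne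
    have := h3 d ((hmem d).2 hd3)
    omega
  have hmono : ∀ r s, r < s → s < N → F (r + 1) ≤ F s := by
    intro r s hrs
    induction s, hrs using Nat.le_induction with
    | base => exact fun _ => le_rfl
    | succ s hs ih =>
      intro hsN
      exact (ih (by omega)).trans
        ((hFE s (by omega)).2.2.1.trans (hgap s hsN).1.le)
  have hwin : ∀ i : Fin ((bL L v - 1) / 3), 3 * (i : ℕ) + 3 < N := fun i => by
    have := i.2
    omega
  have hcyc := fun i : Fin ((bL L v - 1) / 3) =>
    have h0 := hFE (3 * i) (by have := hwin i; omega)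
    have h1 := hFE (3 * i + 1) (by have := hwin i; omega)
    have h2 := hFE (3 * i + 2) (by have := hwin i; omega)
    have h3 := hFE (3 * i + 3) (hwin i)
    have g1 := hgap (3 * i) (by have := hwin i; omega)
    have g2 := hgap (3 * i + 1) (by have := hwin i; omega)
    have g3 := hgap (3 * i + 2) (hwin i)
    exists_cycle_goodArc hL hv g1.1 h1.2.2.1 g2.1 h2.2.2.1 g3.1 ((hmem _).1 h0.2.1)
      ((hmem _).1 h1.1) ((hmem _).1 h1.2.1) ((hmem _).1 h2.1) ((hmem _).1 h2.2.1)
      ((hmem _).1 h3.1) (hcons _ (by have := hwin i; omega)) (hcons _ (by have := hwin i; omega))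
      (hcons _ (hwin i)) g1.2.1 h1.2.2.2 g2.2.1 h2.2.2.2 g3.2.1
  choose T hT using hcyc
  refine ⟨fun i => E (3 * i), fun i => F (3 * i + 3), T, fun i j hij => ?_, hT⟩
  have hij' : (i : ℕ) < j := hij
  have hj := hwin j
  exact (hmono (3 * i + 2) (3 * j) (by omega) (by omega)).trans
    (hFE (3 * j) (by omega)).2.2.1

end GoodArcs

/-- many neighbor-wise independent good arcs out of a cyclic vertex,
max-3-cut on the complete graph. For every cyclic vertex `v` of a valid sequence `L` there
are `m ≥ ⌈⌊(b_L(v)−1)/3⌋/2⌉` distinct acyclic vertices `u 0, …, u (m−1)` together with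
cycles `C 0, …, C (m−1)` over `v` such that `P_{L,τ0}[{v,u i},C i] ≠ 0` and
`P_{L,τ0}[{v,u j},C i] = 0` for `j > i`; in particular every `v (u i)` is an `L`-good-arc
and `{v u 0, …, v u (m−1)}` is an `L`-neighbor-wise independent set. -/
theorem cyclic_vertex_goodArcs_nbrIndep {n : ℕ}
    (L : List (KMove n 3)) (τ0 : Fin n → Fin 3) (hvalid : kValid τ0 L)
    (v : Fin n) (hv : v ∈ cyclicSet L) :
    ∃ (m : ℕ) (u : Fin m → Fin n) (C : Fin m → Finset (Fin L.length)),
      ((bL L v - 1) / 3 + 1) / 2 ≤ m ∧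
      Function.Injective u ∧
      (∀ i, u i ∈ acyclicSet L) ∧
      (∀ i, u i ≠ v) ∧
      (∀ i, IsCycle L v (C i)) ∧
      (∀ i, kPval L τ0 v (u i) (C i) ≠ 0) ∧
      (∀ i j, i < j → kPval L τ0 v (u j) (C i) = 0) := by
  obtain ⟨a, b, T, hab, hT⟩ := exists_window_cycles hvalid hv
  obtain ⟨U, hUA, hcard, hpriv⟩ := exists_private_partners (acyclicSet L)
    (fun u i => kPval L τ0 v u (T i) ≠ 0) (fun i => (hT i).2.1) fun u hu I hI =>
      card_windows_le_two hvalid (Finset.mem_sdiff.1 hu).2 hab I fun i hi =>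
        (hT i).2.2 u (ne_of_mem_acyclicSet hu hv) (hI i hi)
  choose p hp hp' using hpriv
  have hmem : ∀ i, (U.equivFin.symm i : Fin n) ∈ U := fun i => (U.equivFin.symm i).2
  have hinj : Function.Injective fun i => (U.equivFin.symm i : Fin n) :=
    Subtype.val_injective.comp U.equivFin.symm.injective
  refine ⟨U.card, fun i => U.equivFin.symm i, fun i => T (p _ (hmem i)), ?_, hinj,
    fun i => hUA (hmem i), fun i => ne_of_mem_acyclicSet (hUA (hmem i)) hv, fun i => (hT _).1,
    fun i => hp _ (hmem i), fun i j hij => ?_⟩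
  · rw [Fintype.card_fin] at hcard
    omega
  · exact not_not.1 (hp' _ _ _ (hmem j) fun h => hij.ne' (hinj h))
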